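/- For all integers N ≥ 2 and k ≥ 1, det(B_{k,N}) ≠ 0, where B_{k,N} is the matrix with (i,j)-entry B̃_k(ij/N), indexed by 0 ≤ i,j ≤ N⁺ when k is even and by 1 ≤ i,j ≤ N⁻ when k is odd (with the convention B̃_1 = 0 at integers when k = 1). -/

import Mathlib

open scoped Classical in
/-- The periodic Bernoulli function `B̃_k(x) = B_k({x})`, with the convention
`B̃_1(x) = 0` for integer `x`. -/
noncomputable def periodicBernoulli (k : ℕ) (x : ℝ) : ℝ :=
  if k = 1 ∧ Int.fract x = 0 then 0
  else Polynomial.aeval (Int.fract x) (Polynomial.bernoulli k)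

/-- For even `k`, the Bernoulli matrix `B_{k,N} = (B̃_k(ij/N))_{0 ≤ i,j ≤ N⁺}`,
where `N⁺ = ⌊N/2⌋`. -/
noncomputable def bernoulliMatrixEven (k N : ℕ) :
    Matrix (Fin (N / 2 + 1)) (Fin (N / 2 + 1)) ℝ :=
  Matrix.of fun i j => periodicBernoulli k (((i : ℕ) * (j : ℕ) : ℕ) / (N : ℝ))

/-- For odd `k`, the Bernoulli matrix `B_{k,N} = (B̃_k(ij/N))_{1 ≤ i,j ≤ N⁻}`,
where `N⁻ = ⌊(N−1)/2⌋`. -/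
noncomputable def bernoulliMatrixOdd (k N : ℕ) :
    Matrix (Fin ((N - 1) / 2)) (Fin ((N - 1) / 2)) ℝ :=
  Matrix.of fun i j =>
    periodicBernoulli k ((((i : ℕ) + 1) * ((j : ℕ) + 1) : ℕ) / (N : ℝ))

section

open HurwitzZeta Filter Topology Complex
open scoped Real

/-- The coefficients of the Dirichlet series are of bounded variation, uniformly for `1 ≤ s ≤ 2`. -/
lemma norm_one_div_succ_cpow_sub_le {s : ℝ} (h1 : 1 ≤ s) (h2 : s ≤ 2) (n : ℕ) :
    ‖1 / ((n + 1 : ℕ) : ℂ) ^ (s : ℂ) - 1 / (n : ℂ) ^ (s : ℂ)‖ ≤ 4 / ((n : ℝ) + 1) ^ 2 := by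
  rcases Nat.eq_zero_or_pos n with rfl | hn
  · have : s ≠ 0 := by linarith
    simp [this]
  have hn' : (1 : ℝ) ≤ n := by exact_mod_cast hn
  have e (m : ℕ) : 1 / (m : ℂ) ^ (s : ℂ) = ((1 / (m : ℝ) ^ s : ℝ) : ℂ) := by
    rw [ofReal_div, ofReal_cpow (by positivity)]; simp
  rw [e, e, ← ofReal_sub, norm_real, Real.norm_eq_abs, abs_sub_comm]
  have hb := one_add_mul_self_le_rpow_one_add (s := -1 / ((n : ℝ) + 1))
    (by rw [le_div_iff₀ (by positivity)]; linarith) h1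
  have hq : 1 + -1 / ((n : ℝ) + 1) = n / (n + 1) := by field_simp; ring
  rw [hq, Real.div_rpow (by positivity) (by positivity)] at hb
  have hp : (n : ℝ) ≤ (n : ℝ) ^ s := by simpa using Real.rpow_le_rpow_of_exponent_le hn' h1
  have hm : (n : ℝ) ^ s ≤ ((n : ℝ) + 1) ^ s :=
    Real.rpow_le_rpow (by positivity) (by linarith) (by linarith)
  have hA : 0 < (n : ℝ) ^ s := by positivity
  have hB : 0 < ((n : ℝ) + 1) ^ s := by positivity
  push_cast
  rw [abs_of_nonneg (sub_nonneg.2 (one_div_le_one_div_of_le hA hm))]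
  have key : 1 / (n : ℝ) ^ s - 1 / ((n : ℝ) + 1) ^ s =
      (1 - (n : ℝ) ^ s / ((n : ℝ) + 1) ^ s) * (1 / (n : ℝ) ^ s) := by
    field_simp
  rw [key]
  calc _ ≤ (s / (n + 1)) * (1 / n) := by
        gcongr
        · have : s * (-1 / ((n : ℝ) + 1)) = - (s / (n + 1)) := by ring
          linarith
    _ ≤ (2 / (n + 1)) * (2 / (n + 1)) := by
        refine mul_le_mul (by gcongr) ?_ (by positivity) (by positivity)
        rw [div_le_div_iff₀ (by positivity) (by positivity)]; linarith
    _ = _ := by field_simp; ring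

lemma one_sub_mul_eq_tsum_of_hasSum {u : ℕ → ℂ} (h0 : u 0 = 0) {w S : ℂ}
    (h : HasSum (fun n ↦ u n * w ^ n) S) :
    (1 - w) * S = ∑' n, (u (n + 1) - u n) * w ^ (n + 1) := by
  have h1 : HasSum (fun n ↦ u (n + 1) * w ^ (n + 1)) S := by
    simpa [h0] using (hasSum_nat_add_iff (f := fun n ↦ u n * w ^ n) 1 (g := S)).2 (by simpa [h0])
  rw [← (h1.sub (h.mul_left w)).tsum_eq.trans (by ring : S - w * S = (1 - w) * S)]
  exact tsum_congr fun n ↦ by ring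

lemma summable_four_div_succ_sq : Summable fun n : ℕ ↦ 4 / ((n : ℝ) + 1) ^ 2 := by
  have := ((summable_nat_add_iff 1).2 (Real.summable_one_div_nat_pow.2 one_lt_two)).mul_left 4
  simpa [div_eq_mul_inv] using this

lemma tendsto_tsum_one_div_succ_cpow_sub {ι : Type*} {l : Filter ι} {s : ι → ℝ} {w : ι → ℂ} {z : ℂ}
    (hs : Tendsto s l (𝓝 1)) (hs1 : ∀ᶠ i in l, 1 ≤ s i) (hw : Tendsto w l (𝓝 z))
    (hw1 : ∀ᶠ i in l, ‖w i‖ ≤ 1) :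
    Tendsto (fun i ↦ ∑' n : ℕ, (1 / ((n + 1 : ℕ) : ℂ) ^ (s i : ℂ) - 1 / (n : ℂ) ^ (s i : ℂ)) *
      w i ^ (n + 1)) l
      (𝓝 (∑' n : ℕ, (1 / ((n + 1 : ℕ) : ℂ) ^ (1 : ℂ) - 1 / (n : ℂ) ^ (1 : ℂ)) * z ^ (n + 1))) := by
  refine tendsto_tsum_of_dominated_convergence summable_four_div_succ_sq (fun n ↦ ?_) ?_
  · have hc (m : ℕ) : Tendsto (fun i ↦ 1 / (m : ℂ) ^ (s i : ℂ)) l (𝓝 (1 / (m : ℂ) ^ (1 : ℂ))) := by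
      have hs' : Tendsto (fun i ↦ (s i : ℂ)) l (𝓝 1) := by
        simpa [Function.comp_def] using (continuous_ofReal.tendsto 1).comp hs
      rcases Nat.eq_zero_or_pos m with rfl | hm
      · refine tendsto_const_nhds.congr' ?_
        filter_upwards [hs1] with i hi
        have : s i ≠ 0 := by linarith
        simp [this]
      · have hm' : (m : ℂ) ≠ 0 := by exact_mod_cast hm.ne'
        exact (tendsto_const_nhds.div (hs'.const_cpow (.inl hm')) (by simp [hm']))
    exact ((hc _).sub (hc _)).mul (hw.pow _)
  · filter_upwards [hs1, hs.eventually_le_const one_lt_two, hw1] with i h1 h2 h3 n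
    rw [norm_mul, norm_pow]
    exact (mul_le_of_le_one_right (norm_nonneg _) (pow_le_one₀ (norm_nonneg _) h3)).trans
      (norm_one_div_succ_cpow_sub_le h1 h2 n)

lemma expZeta_one {x : ℝ} (hx : (x : UnitAddCircle) ≠ 0) :
    expZeta x 1 = -log (1 - cexp (2 * π * I * x)) := by
  have hz : cexp (2 * π * I * x) ≠ 1 := fun h ↦ by
    obtain ⟨n, hn⟩ := Complex.exp_eq_one_iff.1 h
    refine hx ((AddCircle.coe_eq_zero_iff 1).2 ⟨n, ?_⟩)
    have := mul_left_cancel₀ two_pi_I_ne_zero (hn.trans (mul_comm _ _))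
    simpa using (by exact_mod_cast this.symm : (n : ℝ) = x)
  set z := cexp (2 * π * I * x) with hzdef
  have hnz : ‖z‖ = 1 := by
    rw [hzdef, show (2 * π * I * x : ℂ) = ((2 * π * x : ℝ) : ℂ) * I by push_cast; ring,
      norm_exp_ofReal_mul_I]
  have hre : 0 < (1 - z).re := by
    have hle : z.re ≤ 1 := hnz ▸ re_le_norm z
    rcases hle.lt_or_eq with h | h
    · simpa using h
    · refine absurd ?_ hz
      have h2 : z.re ^ 2 + z.im ^ 2 = 1 := by
        have := Complex.sq_norm_sub_sq_re z; rw [hnz] at this; linarith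
      have : z.im = 0 := by rw [h] at h2; nlinarith
      exact Complex.ext (by simpa using h) (by simpa using this)
  refine mul_left_cancel₀ (sub_ne_zero.2 hz.symm) ?_
  have hzero (s : ℝ) (hs : 1 ≤ s) : 1 / ((0 : ℕ) : ℂ) ^ (s : ℂ) = 0 := by
    have : s ≠ 0 := by linarith
    simp [this]
  have lim1 : Tendsto (fun s : ℝ ↦ (1 - z) * expZeta x s) (𝓝[>] 1) (𝓝 ((1 - z) * expZeta x 1)) := by
    have hc : ContinuousAt (fun s : ℝ ↦ expZeta x (s : ℂ)) 1 :=
      ((differentiable_expZeta_of_ne_zero hx).continuous.comp continuous_ofReal).continuousAt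
    simpa using (hc.tendsto.mono_left nhdsWithin_le_nhds).const_mul (1 - z)
  have lim2 : Tendsto (fun r : ℝ ↦ (1 - r * z) * -log (1 - r * z)) (𝓝[<] 1)
      (𝓝 ((1 - z) * -log (1 - z))) := by
    have hc : ContinuousAt (fun r : ℝ ↦ (1 - r * z) * -log (1 - r * z)) 1 := by
      refine ContinuousAt.mul (by fun_prop) (ContinuousAt.neg (ContinuousAt.clog (by fun_prop) ?_))
      exact .inl (by simpa using hre)
    simpa using hc.tendsto.mono_left nhdsWithin_le_nhds
  have D1 := tendsto_tsum_one_div_succ_cpow_sub (l := 𝓝[>] (1 : ℝ)) (s := fun s ↦ s)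
    (w := fun _ ↦ z) (z := z) (tendsto_id.mono_left nhdsWithin_le_nhds)
    (by filter_upwards [self_mem_nhdsWithin] with s hs using le_of_lt hs) tendsto_const_nhds
    (by simp [hnz])
  have D2 := tendsto_tsum_one_div_succ_cpow_sub (l := 𝓝[<] (1 : ℝ)) (s := fun _ ↦ 1)
    (w := fun r ↦ r * z) (z := z) tendsto_const_nhds (by simp)
    (by
      have : ContinuousAt (fun r : ℝ ↦ (r : ℂ) * z) 1 := by fun_prop
      simpa using this.tendsto.mono_left nhdsWithin_le_nhds)
    (by
      filter_upwards [Ioo_mem_nhdsLT (zero_lt_one' ℝ)] with r hr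
      rw [norm_mul, hnz, norm_real, Real.norm_eq_abs, abs_of_pos hr.1, mul_one]
      exact hr.2.le)
  have E1 := tendsto_nhds_unique (lim1.congr' ?_) D1
  · have E2 := tendsto_nhds_unique (lim2.congr' ?_) D2
    · rw [E1, E2]
    · filter_upwards [Ioo_mem_nhdsLT (zero_lt_one' ℝ)] with r hr
      refine one_sub_mul_eq_tsum_of_hasSum (u := fun n : ℕ ↦ 1 / (n : ℂ) ^ ((1 : ℝ) : ℂ))
        (hzero 1 le_rfl) ?_
      have : ‖(r : ℂ) * z‖ < 1 := by
        rw [norm_mul, hnz, norm_real, Real.norm_eq_abs, abs_of_pos hr.1, mul_one]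
        exact hr.2
      refine (hasSum_taylorSeries_neg_log this).congr_fun ?_
      intro n
      simp; ring
  · filter_upwards [self_mem_nhdsWithin] with s hs
    refine one_sub_mul_eq_tsum_of_hasSum (u := fun n : ℕ ↦ 1 / (n : ℂ) ^ (s : ℂ))
      (hzero s (le_of_lt hs)) ?_
    refine (hasSum_expZeta_of_one_lt_re x (s := s) (by simpa using hs)).congr_fun ?_
    intro n
    rw [hzdef, ← Complex.exp_nat_mul, one_div_mul_eq_div]
    rw [show (n : ℂ) * (2 * π * I * x) = 2 * π * I * x * n by ring]

lemma sinZeta_one {x : ℝ} (hx0 : 0 < x) (hx1 : x < 1) : sinZeta x 1 = π * (1 / 2 - x) := by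
  have hx : (x : UnitAddCircle) ≠ 0 := by
    rw [Ne, AddCircle.coe_eq_zero_iff_of_mem_Ico ⟨hx0.le, by simpa using hx1⟩]
    exact hx0.ne'
  set w := 1 - cexp (2 * π * I * x) with hw
  have hpolar : w = (2 * Real.sin (π * x) : ℝ) *
      (cos (π * (x - 1 / 2) : ℝ) + sin (π * (x - 1 / 2) : ℝ) * I) := by
    have h1 : cexp (2 * π * I * x) = (cos (π * x) + sin (π * x) * I) ^ 2 := by
      rw [← exp_mul_I, ← Complex.exp_nat_mul]
      congr 1; push_cast; ring
    have h2 : ((π * (x - 1 / 2) : ℝ) : ℂ) = π * x - π / 2 := by push_cast; ring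
    rw [hw, h1, h2, cos_sub_pi_div_two, sin_sub_pi_div_two]
    push_cast
    linear_combination -(sin (π * x)) ^ 2 * I_sq - sin_sq_add_cos_sq (π * x)
  have hpi := Real.pi_pos
  have harg : w.arg = π * (x - 1 / 2) := by
    rw [hpolar]
    refine arg_mul_cos_add_sin_mul_I ?_ ⟨by nlinarith, by nlinarith⟩
    have := Real.sin_pos_of_pos_of_lt_pi (x := π * x) (by positivity) (by nlinarith)
    positivity
  have e1 := expZeta_one hx
  have e2 := expZeta_one (x := -x) (by simpa using hx)
  have hconj : 1 - cexp (2 * π * I * (-x : ℝ)) = (starRingEnd ℂ) w := by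
    rw [hw, map_sub, ← exp_conj]
    simp [conj_ofNat]
  rw [hconj, log_conj _ (by rw [harg]; nlinarith)] at e2
  rw [expZeta, AddCircle.coe_neg, cosZeta_neg, sinZeta_neg] at e2
  rw [expZeta] at e1
  have h3 : log w - (starRingEnd ℂ) (log w) = 2 * I * (π * (x - 1 / 2)) := by
    rw [sub_conj, log_im, harg]; push_cast; ring
  refine mul_left_cancel₀ (mul_ne_zero two_ne_zero I_ne_zero) ?_
  linear_combination e1 - e2 - h3

section
variable {N : ℕ} [NeZero N]

lemma exists_dirichletCharacter_eq (l : ZMod N →* ℂ) :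
    ∃ (m : ℕ) (_ : NeZero m) (χ : DirichletCharacter ℂ m), ∀ n : ℤ, χ n = l n := by
  classical
  have hex : ∃ m : ℕ, 0 < m ∧ ∀ x : ZMod N, l (x + m) = l x :=
    ⟨N, NeZero.pos N, fun x ↦ by simp⟩
  obtain ⟨hm, hper⟩ := Nat.find_spec hex
  have hmin (j : ℕ) (hj : j < Nat.find hex) := Nat.find_min hex hj
  generalize Nat.find hex = m at hm hper hmin
  have : NeZero m := ⟨hm.ne'⟩
  have hperiodic (x : ZMod N) (q : ℤ) : l (x + q * m) = l x := by
    have hp : Function.Periodic l (m : ZMod N) := hper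
    exact hp.int_mul q x
  have hcongr {a b : ℤ} (h : (a : ZMod m) = b) : l a = l b := by
    obtain ⟨q, hq⟩ := (ZMod.intCast_eq_intCast_iff_dvd_sub _ _ _).1 h
    rw [show b = a + q * m by linarith, Int.cast_add, Int.cast_mul, Int.cast_natCast, hperiodic]
  have hcast (a : ZMod m) : ((a.val : ℤ) : ZMod m) = a := by simp
  let χ : DirichletCharacter ℂ m :=
    { toFun := fun a ↦ l ((a.val : ℤ) : ZMod N)
      map_one' := by
        rw [hcongr (b := 1) (by rw [hcast]; simp)]; simp
      map_mul' := fun a b ↦ by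
        rw [← map_mul, ← Int.cast_mul]
        exact hcongr (by rw [Int.cast_mul, hcast, hcast, hcast])
      map_nonunit' := fun a ha ↦ by
        have hco : ¬ Nat.Coprime a.val m := fun h ↦ ha (by
          rw [← ZMod.natCast_zmod_val a]; exact (ZMod.isUnit_iff_coprime _ _).2 h)
        obtain ⟨p, hp, ⟨c, hc⟩, ⟨d, hd⟩⟩ := Nat.Prime.not_coprime_iff_dvd.1 hco
        by_contra hne
        have hne : l ((a.val : ℤ) : ZMod N) ≠ 0 := hne
        have hlp : l (p : ZMod N) ≠ 0 := fun h ↦ hne (by simp [hc, h])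
        have hd0 : 0 < d := Nat.pos_of_ne_zero (by rintro rfl; simp at hd; omega)
        refine hmin d ?_ ⟨hd0, fun x ↦ mul_left_cancel₀ hlp ?_⟩
        · rw [hd]; exact lt_mul_left hd0 hp.one_lt
        · rw [← map_mul, ← map_mul, mul_add, ← Nat.cast_mul, ← hd, hper] }
  exact ⟨m, this, χ, fun n ↦ hcongr (hcast _)⟩

lemma LFunction_monoidHom_ne_zero (l : ZMod N →* ℂ) {k : ℕ} (hk : 1 ≤ k)
    (h1 : k = 1 → l (-1) = -1) : ZMod.LFunction l k ≠ 0 := by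
  obtain ⟨m, _, χ, hχ⟩ := exists_dirichletCharacter_eq l
  have heq {s : ℂ} (hs : 1 < s.re) : ZMod.LFunction l s = DirichletCharacter.LFunction χ s := by
    rw [ZMod.LFunction_eq_LSeries _ hs, DirichletCharacter.LFunction_eq_LSeries _ hs]
    exact LSeries_congr (fun {n} _ ↦ by simpa using (hχ n).symm) s
  rcases hk.eq_or_lt with rfl | hk
  · have hodd := h1 rfl
    have hχ1 : χ ≠ 1 := by
      rintro rfl
      have := hχ (-1)
      rw [MulChar.one_apply (by simp)] at this
      simp [hodd] at this
      norm_num at this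
    have hsum : ∑ j, l j = 0 := by
      have hneg : Function.Odd l := fun x ↦ by rw [← neg_one_mul, map_mul, hodd, neg_one_mul]
      exact hneg.sum_eq_zero
    have c1 : Continuous fun s : ℝ ↦ ZMod.LFunction l s :=
      (ZMod.differentiable_LFunction_of_sum_zero hsum).continuous.comp continuous_ofReal
    have c2 : Continuous fun s : ℝ ↦ DirichletCharacter.LFunction χ s :=
      (DirichletCharacter.differentiable_LFunction hχ1).continuous.comp continuous_ofReal
    have hlim : ZMod.LFunction l (1 : ℝ) = DirichletCharacter.LFunction χ (1 : ℝ) := by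
      refine tendsto_nhds_unique ((c1.tendsto 1).mono_left nhdsWithin_le_nhds |>.congr' ?_)
        ((c2.tendsto 1).mono_left (nhdsWithin_le_nhds (s := Set.Ioi 1)))
      filter_upwards [self_mem_nhdsWithin] with s hs
      exact heq (by simpa using hs)
    have := DirichletCharacter.LFunction_ne_zero_of_one_le_re χ (s := 1) (.inl hχ1) (by simp)
    rw [ofReal_one] at hlim
    rwa [Nat.cast_one, hlim]
  · rw [heq (by simpa using hk)]
    exact DirichletCharacter.LFunction_ne_zero_of_one_le_re χ (.inr (by exact_mod_cast hk.ne'))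
      (by simpa using hk.le)

end

lemma exists_common_eigenvector {ι K V : Type*} [Field K] [IsAlgClosed K] [AddCommGroup V]
    [Module K V] [FiniteDimensional K V] {f : ι → Module.End K V}
    (hf : ∀ i j, Commute (f i) (f j)) {W : Submodule K V} (hW : W ≠ ⊥)
    (hfW : ∀ i, ∀ v ∈ W, f i v ∈ W) :
    ∃ v ∈ W, v ≠ 0 ∧ ∀ i, ∃ μ : K, f i v = μ • v := by
  obtain ⟨U, ⟨hUW, hU, hfU⟩, hmin⟩ := IsArtinian.set_has_minimal
    {U : Submodule K V | U ≤ W ∧ U ≠ ⊥ ∧ ∀ i, ∀ v ∈ U, f i v ∈ U} ⟨W, le_rfl, hW, hfW⟩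
  obtain ⟨v, hv, hv0⟩ := U.ne_bot_iff.1 hU
  refine ⟨v, hUW hv, hv0, fun i ↦ ?_⟩
  have : Nontrivial U := Submodule.nontrivial_iff_ne_bot.2 hU
  obtain ⟨μ, hμ⟩ := Module.End.exists_eigenvalue ((f i).restrict (hfU i))
  obtain ⟨w, hw⟩ := hμ.exists_hasEigenvector
  have hw' : f i w = μ • (w : V) := congrArg Subtype.val hw.apply_eq_smul
  refine ⟨μ, ?_⟩
  have hE : U ⊓ (f i).eigenspace μ = U := by
    by_contra hne
    refine hmin _ ⟨inf_le_left.trans hUW, ?_, fun j u hu ↦ ⟨hfU j u hu.1, ?_⟩⟩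
      (lt_of_le_of_ne inf_le_left hne)
    · exact (Submodule.ne_bot_iff _).2 ⟨w, ⟨w.2, Module.End.mem_eigenspace_iff.2 hw'⟩,
        fun h ↦ hw.2 (Subtype.ext h)⟩
    · have := Module.End.mem_eigenspace_iff.1 hu.2
      rw [SetLike.mem_coe, Module.End.mem_eigenspace_iff, ← Module.End.mul_apply, (hf i j).eq,
        Module.End.mul_apply, this, map_smul]
  exact Module.End.mem_eigenspace_iff.1 (hE.ge hv).2

lemma periodicBernoulli_val_natCast {N : ℕ} (k n : ℕ) :
    periodicBernoulli k (((n : ZMod N)).val / (N : ℝ)) = periodicBernoulli k (n / (N : ℝ)) := by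
  have : Int.fract ((((n : ZMod N)).val : ℝ) / N) = Int.fract ((n : ℝ) / N) := by
    rw [Int.fract_div_natCast_eq_div_natCast_mod, Int.fract_div_natCast_eq_div_natCast_mod,
      ZMod.val_natCast, Nat.mod_mod]
  simp only [periodicBernoulli, this]

section
variable {N : ℕ} [NeZero N]

/-- The symmetrized exponential zeta function at a positive integer is a multiple of the periodic
Bernoulli function. -/
lemma exists_LFunction_stdAddChar_add_eq {k : ℕ} (hk : 1 ≤ k) : ∃ c : ℂ, ∀ y : ZMod N,
    ZMod.LFunction (fun x ↦ ZMod.stdAddChar (-y * x)) k +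
      (-1) ^ k * ZMod.LFunction (fun x ↦ ZMod.stdAddChar (y * x)) k =
    c * periodicBernoulli k (y.val / (N : ℝ)) := by
  have hN : (0 : ℝ) < N := Nat.cast_pos.2 (NeZero.pos N)
  have hx0 (y : ZMod N) : 0 ≤ (y.val / N : ℝ) := by positivity
  have hx1 (y : ZMod N) : (y.val / N : ℝ) < 1 := by
    rw [div_lt_one hN]; exact_mod_cast ZMod.val_lt y
  have hB (y : ZMod N) (h : ¬ (k = 1 ∧ y = 0)) :
      (periodicBernoulli k (y.val / (N : ℝ)) : ℂ) =
      ((Polynomial.bernoulli k).map (algebraMap ℚ ℂ)).eval ((y.val / N : ℝ) : ℂ) := by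
    have hf : Int.fract (y.val / N : ℝ) = y.val / N := Int.fract_eq_self.2 ⟨hx0 y, hx1 y⟩
    have : ¬ (k = 1 ∧ (y.val / N : ℝ) = 0) := by
      simpa [hN.ne', -ZMod.natCast_val] using h
    rw [periodicBernoulli, hf, if_neg this, Polynomial.eval_map_algebraMap]
    exact (Polynomial.aeval_algebraMap_apply ℂ (y.val / N : ℝ) _).symm
  have hL (y : ZMod N) (h : y ≠ 0 ∨ (k : ℂ) ≠ 1) :
      ZMod.LFunction (fun x ↦ ZMod.stdAddChar (-y * x)) k +
        (-1) ^ k * ZMod.LFunction (fun x ↦ ZMod.stdAddChar (y * x)) k =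
      (1 + (-1) ^ k) * cosZeta ((y.val / N : ℝ) : UnitAddCircle) k +
        ((-1) ^ k - 1) * I * sinZeta ((y.val / N : ℝ) : UnitAddCircle) k := by
    rw [ZMod.LFunction_stdAddChar_eq_expZeta _ _ h,
      ZMod.LFunction_stdAddChar_eq_expZeta _ _ (by simpa using h), map_neg, expZeta, expZeta,
      cosZeta_neg, sinZeta_neg, ZMod.toAddCircle_apply]
    ring
  rcases Nat.even_or_odd' k with ⟨r, rfl | rfl⟩
  · have hr : r ≠ 0 := by omega
    have hk1 : ((2 * r : ℕ) : ℂ) ≠ 1 := by norm_cast; omega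
    refine ⟨2 * ((-1) ^ (r + 1) * (2 * π) ^ (2 * r) / 2 / (2 * r).factorial), fun y ↦ ?_⟩
    rw [hL y (.inr hk1), hB y (by omega)]
    push_cast
    have := cosZeta_two_mul_nat hr ⟨hx0 y, (hx1 y).le⟩
    push_cast at this
    rw [this]
    simp only [pow_mul, neg_one_sq, one_pow]
    ring
  · rcases eq_or_ne r 0 with rfl | hr
    · refine ⟨2 * π * I, fun y ↦ ?_⟩
      rcases eq_or_ne y 0 with rfl | hy
      · simp [periodicBernoulli]
      · rw [hL y (.inl hy), hB y (by simp [hy])]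
        have hpos : 0 < (y.val / N : ℝ) :=
          div_pos (Nat.cast_pos.2 (Nat.pos_of_ne_zero (by simpa using hy))) hN
        have := sinZeta_one hpos (hx1 y)
        simp [Polynomial.bernoulli_one] at this ⊢
        rw [this]
        ring
    · have hk1 : ((2 * r + 1 : ℕ) : ℂ) ≠ 1 := by norm_cast; omega
      refine ⟨-2 * I * ((-1) ^ (r + 1) * (2 * π) ^ (2 * r + 1) / 2 / (2 * r + 1).factorial),
        fun y ↦ ?_⟩
      rw [hL y (.inr hk1), hB y (by omega)]
      push_cast
      have := sinZeta_two_mul_nat_add_one hr ⟨hx0 y, (hx1 y).le⟩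
      push_cast at this
      rw [this]
      simp only [pow_succ, pow_mul]
      ring

lemma LFunction_sum {ι : Type*} (t : Finset ι) (F : ι → ZMod N → ℂ) (s : ℂ) :
    ZMod.LFunction (fun x ↦ ∑ i ∈ t, F i x) s = ∑ i ∈ t, ZMod.LFunction (F i) s := by
  simp only [ZMod.LFunction, Finset.sum_mul, ← Finset.mul_sum]
  rw [Finset.sum_comm]

lemma LFunction_add (F G : ZMod N → ℂ) (s : ℂ) :
    ZMod.LFunction (fun x ↦ F x + G x) s = ZMod.LFunction F s + ZMod.LFunction G s := by
  simp only [ZMod.LFunction, add_mul, Finset.sum_add_distrib, mul_add]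

lemma LFunction_const_mul (c : ℂ) (F : ZMod N → ℂ) (s : ℂ) :
    ZMod.LFunction (fun x ↦ c * F x) s = c * ZMod.LFunction F s := by
  simp only [ZMod.LFunction, mul_assoc, ← Finset.mul_sum]
  ring

variable (N) in
/-- Functions of the parity of `k` all of whose dilates have an L-function vanishing at `k`. -/
def dilateLFunctionKer (k : ℕ) : Submodule ℂ (ZMod N → ℂ) where
  carrier := {g | (∀ x, g (-x) = (-1) ^ k * g x) ∧
    ∀ i : ZMod N, ZMod.LFunction (fun x ↦ g (i * x)) k = 0}
  add_mem' := fun {f g} hf hg ↦ ⟨fun x ↦ by simp [hf.1, hg.1, mul_add],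
    fun i ↦ by simp [LFunction_add, hf.2 i, hg.2 i]⟩
  zero_mem' := ⟨fun x ↦ by simp, fun i ↦ by simp [ZMod.LFunction]⟩
  smul_mem' := fun c g hg ↦ ⟨fun x ↦ by simp only [Pi.smul_apply, smul_eq_mul, hg.1]; ring,
    fun i ↦ by simp [LFunction_const_mul, hg.2 i]⟩

lemma dilateLFunctionKer_eq_bot {k : ℕ} (hk : 1 ≤ k) : dilateLFunctionKer N k = ⊥ := by
  by_contra hne
  obtain ⟨g, hg, hg0, hμ⟩ := exists_common_eigenvector
    (f := fun n : ZMod N ↦ LinearMap.funLeft ℂ ℂ (n * ·))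
    (fun m n ↦ LinearMap.ext fun h ↦ funext fun x ↦ congrArg h (mul_left_comm n m x)) hne
    (fun n h hh ↦ ⟨fun x ↦ by simpa [LinearMap.funLeft_apply] using hh.1 (n * x),
      fun i ↦ by simpa [LinearMap.funLeft_apply, mul_assoc] using hh.2 (n * i)⟩)
  choose μ hμ using hμ
  have hmul (n x : ZMod N) : g (n * x) = μ n * g x := congrFun (hμ n) x
  have hval (n : ZMod N) : g n = μ n * g 1 := by simpa using hmul n 1
  have hg1 : g 1 ≠ 0 := fun h ↦ hg0 (funext fun n ↦ by simp [hval n, h])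
  let l : ZMod N →* ℂ :=
    { toFun := fun n ↦ (g 1)⁻¹ * g n
      map_one' := inv_mul_cancel₀ hg1
      map_mul' := fun m n ↦ by rw [hmul m n, hval m]; field_simp }
  refine LFunction_monoidHom_ne_zero l hk (fun h ↦ ?_) ?_
  · have := hg.1 1
    rw [h, pow_one] at this
    change (g 1)⁻¹ * g (-1) = -1
    rw [this]; field_simp
  · have := hg.2 1
    simp only [one_mul] at this
    exact (LFunction_const_mul _ g k).trans (by rw [this, mul_zero])

lemma det_periodicBernoulli_ne_zero {ι : Type*} [Fintype ι] [DecidableEq ι] {k : ℕ} (hk : 1 ≤ k)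
    (a : ι → ZMod N) (hinj : Function.Injective a)
    (hneg : ∀ i j, a i = -a j → i = j ∧ Even k)
    (hcover : ∀ x, (∃ i, x = a i ∨ x = -a i) ∨ (Odd k ∧ x = -x)) :
    (Matrix.of fun i j ↦ periodicBernoulli k ((a i * a j).val / (N : ℝ))).det ≠ 0 := by
  intro hdet
  obtain ⟨v, hv0, hv⟩ := Matrix.exists_mulVec_eq_zero_iff.2 hdet
  obtain ⟨c, hc⟩ := exists_LFunction_stdAddChar_add_eq (N := N) hk
  let φ : ZMod N → ℂ := fun x ↦ ∑ j, (v j : ℂ) *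
    (ZMod.stdAddChar (-a j * x) + (-1) ^ k * ZMod.stdAddChar (a j * x))
  have hsq : ((-1 : ℂ) ^ k) * (-1) ^ k = 1 := by rw [← mul_pow]; simp
  have hpar (x : ZMod N) : φ (-x) = (-1) ^ k * φ x := by
    simp only [φ, Finset.mul_sum]
    refine Finset.sum_congr rfl fun j _ ↦ ?_
    rw [neg_mul_neg, mul_neg, ← neg_mul]
    linear_combination -(v j : ℂ) * ZMod.stdAddChar (a j * x) * hsq
  have hdil (i : ZMod N) : ZMod.LFunction (fun x ↦ φ (i * x)) k =
      c * ∑ j, (periodicBernoulli k ((i * a j).val / (N : ℝ)) : ℂ) * v j := by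
    simp only [φ, LFunction_sum, LFunction_const_mul, LFunction_add, Finset.mul_sum]
    refine Finset.sum_congr rfl fun j _ ↦ ?_
    have := hc (i * a j)
    simp only [show ∀ x, -(i * a j) * x = -a j * (i * x) from fun x ↦ by ring,
      show ∀ x, i * a j * x = a j * (i * x) from fun x ↦ by ring] at this
    rw [this]; ring
  have hdilneg (i : ZMod N) : ZMod.LFunction (fun x ↦ φ (-i * x)) k =
      (-1) ^ k * ZMod.LFunction (fun x ↦ φ (i * x)) k := by
    simp only [neg_mul, hpar, LFunction_const_mul]
  have hrow (i : ι) : ZMod.LFunction (fun x ↦ φ (a i * x)) k = 0 := by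
    have := congrFun hv i
    simp only [Matrix.mulVec, dotProduct, Matrix.of_apply, Pi.zero_apply] at this
    rw [hdil]
    simp only [← ofReal_mul, ← ofReal_sum, this, ofReal_zero, mul_zero]
  have hmem : φ ∈ dilateLFunctionKer N k := by
    refine ⟨hpar, fun x ↦ ?_⟩
    rcases hcover x with ⟨i, rfl | rfl⟩ | ⟨hodd, hx⟩
    · exact hrow i
    · rw [hdilneg, hrow, mul_zero]
    · have := hdilneg x
      rw [← hx, hodd.neg_one_pow, neg_one_mul] at this
      exact self_eq_neg.1 this
  rw [dilateLFunctionKer_eq_bot hk, Submodule.mem_bot] at hmem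
  obtain ⟨l, hl⟩ := Function.ne_iff.1 hv0
  have hN : (N : ℂ) ≠ 0 := NeZero.ne _
  have horth (b : ZMod N) : ∑ x, (ZMod.stdAddChar (x * b) : ℂ) = if b = 0 then (N : ℂ) else 0 := by
    rw [AddChar.sum_mulShift b (ZMod.isPrimitive_stdAddChar N)]
    simp [ZMod.card]
  have hsum : ∑ x, φ x * ZMod.stdAddChar (a l * x) = ∑ j, (v j : ℂ) *
      ((if a l - a j = 0 then (N : ℂ) else 0) +
        (-1) ^ k * (if a l + a j = 0 then (N : ℂ) else 0)) := by
    simp only [← horth, φ, Finset.sum_mul, Finset.mul_sum, ← Finset.sum_add_distrib]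
    rw [Finset.sum_comm]
    refine Finset.sum_congr rfl fun j _ ↦ Finset.sum_congr rfl fun x _ ↦ ?_
    rw [show x * (a l - a j) = -a j * x + a l * x by ring,
      show x * (a l + a j) = a j * x + a l * x by ring, AddChar.map_add_eq_mul,
      AddChar.map_add_eq_mul]
    ring
  rw [hmem, Finset.sum_eq_single l] at hsum
  · simp only [Pi.zero_apply, zero_mul, Finset.sum_const_zero, sub_self, if_true] at hsum
    have hvl : (v l : ℂ) ≠ 0 := by exact_mod_cast hl
    have h := (mul_eq_zero.1 hsum.symm).resolve_left hvl
    split_ifs at h with h2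
    · rw [(hneg l l (eq_neg_of_add_eq_zero_left h2)).2.neg_one_pow, one_mul, ← two_mul] at h
      simp [hN] at h
    · simp [hN] at h
  · intro j _ hj
    rw [if_neg fun h ↦ hj (hinj (sub_eq_zero.1 h)).symm,
      if_neg fun h ↦ hj (hneg l j (eq_neg_of_add_eq_zero_left h)).1.symm]
    simp
  · simp

end

end

/-- For all `N ≥ 2` and `k ≥ 1`, the determinant of the Bernoulli matrix `B_{k,N}`
does not vanish. -/
theorem det_bernoulliMatrix_ne_zero (N k : ℕ) (hN : 2 ≤ N) (hk : 1 ≤ k) :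
    (Even k → (bernoulliMatrixEven k N).det ≠ 0) ∧
    (Odd k → (bernoulliMatrixOdd k N).det ≠ 0) := by
  have : NeZero N := ⟨by omega⟩
  have hcast {m n : ℕ} (h : (m : ZMod N) = n) (hm : m < N) (hn : n < N) : m = n := by
    rwa [ZMod.natCast_eq_natCast_iff', Nat.mod_eq_of_lt hm, Nat.mod_eq_of_lt hn] at h
  have hadd {m n : ℕ} (h : (m : ZMod N) = -n) : N ∣ m + n := by
    rw [← ZMod.natCast_eq_zero_iff, Nat.cast_add, h, neg_add_cancel]
  have hsub (x : ZMod N) : x = -((N - x.val : ℕ) : ZMod N) := by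
    rw [Nat.cast_sub (ZMod.val_lt x).le]; simp
  refine ⟨fun hev ↦ ?_, fun hodd ↦ ?_⟩
  · have := det_periodicBernoulli_ne_zero (N := N) hk
      (fun i : Fin (N / 2 + 1) ↦ ((i : ℕ) : ZMod N))
      (fun i j h ↦ Fin.ext (hcast h (by omega) (by omega)))
      (fun i j h ↦ ⟨Fin.ext ?_, hev⟩) (fun x ↦ .inl ?_)
    · simpa only [← Nat.cast_mul, periodicBernoulli_val_natCast] using! this
    · obtain ⟨q, hq⟩ := hadd h
      have : q < 2 := by
        by_contra! h2
        have := Nat.mul_le_mul_left N h2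
        omega
      interval_cases q <;> omega
    · have := ZMod.val_lt x
      rcases le_or_gt x.val (N / 2) with h | h
      · exact ⟨⟨x.val, by omega⟩, .inl (by simp)⟩
      · exact ⟨⟨N - x.val, by omega⟩, .inr (hsub x)⟩
  · have := det_periodicBernoulli_ne_zero (N := N) hk
      (fun i : Fin ((N - 1) / 2) ↦ ((i + 1 : ℕ) : ZMod N))
      (fun i j h ↦ Fin.ext (by have := hcast h (by omega) (by omega); omega))
      (fun i j h ↦ ?_) (fun x ↦ ?_)
    · simpa only [← Nat.cast_mul, periodicBernoulli_val_natCast] using! this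
    · have := Nat.le_of_dvd (by omega) (hadd h)
      omega
    · have := ZMod.val_lt x
      rcases Nat.eq_zero_or_pos x.val with h0 | h0
      · exact .inr ⟨hodd, by simp [(ZMod.val_eq_zero x).1 h0]⟩
      rcases le_or_gt x.val ((N - 1) / 2) with h | h
      · exact .inl ⟨⟨x.val - 1, by omega⟩, .inl (by simp [Nat.sub_add_cancel h0])⟩
      rcases le_or_gt (N - x.val) ((N - 1) / 2) with h' | h'
      · refine .inl ⟨⟨N - x.val - 1, by omega⟩, .inr ?_⟩
        rw [Nat.sub_add_cancel (by omega)]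
        exact hsub x
      · refine .inr ⟨hodd, ?_⟩
        conv_rhs => rw [← ZMod.natCast_zmod_val x, show x.val = N - x.val by omega]
        exact hsub x
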